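/- arXiv:1203.3961 — 2 statements merged into one kernel-verified Lean document; each statement's English description precedes it below -/
import Mathlib

section
/- Let M be an m×n matrix with entries in {0,1}. Then the minimum of psdrk(T) over all m×n complex matrices T with real nonnegative entries whose support equals M is equal to the minimum of rank(T) over all complex m×n matrices T whose support equals M. -/
open Matrix
open scoped ComplexOrder

/-- The positive semidefinite rank of a complex `m × n` matrix `S`: the smallest `q`
such that there are complex positive semidefinite `q × q` matrices `A k`, `B ℓ` with
`S k ℓ = tr((A k)ᴴ * B ℓ)` for all `k, ℓ`. -/
noncomputable def psdRankC {m n : ℕ} (S : Matrix (Fin m) (Fin n) ℂ) : ℕ :=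
  sInf {q : ℕ | ∃ (A : Fin m → Matrix (Fin q) (Fin q) ℂ)
      (B : Fin n → Matrix (Fin q) (Fin q) ℂ),
    (∀ k, (A k).PosSemidef) ∧ (∀ ℓ, (B ℓ).PosSemidef) ∧
    ∀ k ℓ, S k ℓ = ((A k)ᴴ * B ℓ).trace}

namespace Matrix

open scoped MatrixOrder Matrix.Norms.L2Operator in
/-- The trace of a product of two positive semidefinite matrices vanishes only if the
product does. -/
theorem PosSemidef.trace_mul_eq_zero_iff {ι : Type*} [Fintype ι] {A B : Matrix ι ι ℂ}
    (hA : A.PosSemidef) (hB : B.PosSemidef) : (A * B).trace = 0 ↔ A * B = 0 := by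
  classical
  refine ⟨fun h => ?_, fun h => by rw [h, trace_zero]⟩
  obtain ⟨C, rfl⟩ := CStarAlgebra.nonneg_iff_eq_star_mul_self.mp hA.nonneg
  obtain ⟨D, rfl⟩ := CStarAlgebra.nonneg_iff_eq_star_mul_self.mp hB.nonneg
  simp only [star_eq_conjTranspose] at h ⊢
  have htr : ((C * Dᴴ)ᴴ * (C * Dᴴ)).trace = 0 := by
    rw [← h, conjTranspose_mul, conjTranspose_conjTranspose, Matrix.mul_assoc,
      trace_mul_comm D, Matrix.mul_assoc, Matrix.mul_assoc, Matrix.mul_assoc]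
  rw [Matrix.mul_assoc, ← Matrix.mul_assoc C, trace_conjTranspose_mul_self_eq_zero_iff.mp htr,
    Matrix.zero_mul, Matrix.mul_zero]

/-- Every matrix over a field factors through a space of dimension its rank. -/
theorem exists_eq_mul_of_rank {m n K : Type*} [Fintype n] [Field K]
    (T : Matrix m n K) :
    ∃ (U : Matrix m (Fin T.rank) K) (V : Matrix (Fin T.rank) n K), T = U * V := by
  classical
  let b : Module.Basis (Fin T.rank) K (LinearMap.range T.mulVecLin) :=
    Module.finBasis K (LinearMap.range T.mulVecLin)
  refine ⟨of fun i j => (b j : m → K) i,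
    of fun j l => b.repr ⟨T.mulVecLin (Pi.single l 1), LinearMap.mem_range_self _ _⟩ j, ?_⟩
  ext i l
  have h := b.sum_repr ⟨T.mulVecLin (Pi.single l 1), LinearMap.mem_range_self _ _⟩
  have hi := congrFun (congrArg Subtype.val h) i
  rw [Submodule.coe_sum, Finset.sum_apply] at hi
  simp only [mulVecLin_apply, mulVec_single_one, Submodule.coe_smul, Pi.smul_apply,
    smul_eq_mul] at hi
  refine hi.symm.trans ?_
  simp only [mul_apply, of_apply, mulVecLin_apply, mulVec_single_one, mul_comm]

end Matrix

/-- Finitely many nonzero linear maps have a common point at which none of them vanishes. -/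
theorem LinearMap.exists_forall_apply_ne_zero {ι K E F : Type*} [Finite ι] [Field K] [Infinite K]
    [AddCommGroup E] [Module K E] [AddCommGroup F] [Module K F] (f : ι → E →ₗ[K] F) :
    ∃ x, ∀ i, f i ≠ 0 → f i x ≠ 0 := by
  by_contra! h
  have hcover : ⋃ i : {i // f i ≠ 0}, (LinearMap.ker (f i) : Set E) = Set.univ := by
    refine Set.eq_univ_of_forall fun x => ?_
    obtain ⟨i, hi, hx⟩ := h x
    exact Set.mem_iUnion.mpr ⟨⟨i, hi⟩, hx⟩
  obtain ⟨i, hi⟩ := Subspace.exists_eq_top_of_iUnion_eq_univ hcover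
  exact i.2 (LinearMap.ker_eq_top.mp hi)

/-- Finitely many matrices over an infinite field admit a bilinear evaluation that is nonzero
on each nonzero one. -/
theorem Matrix.exists_forall_dotProduct_mulVec_ne_zero {ι K m n : Type*} [Finite ι] [Field K]
    [Infinite K] [Fintype m] [Fintype n] (C : ι → Matrix m n K) :
    ∃ (a : m → K) (b : n → K), ∀ i, C i ≠ 0 → a ⬝ᵥ C i *ᵥ b ≠ 0 := by
  classical
  obtain ⟨b, hb⟩ := LinearMap.exists_forall_apply_ne_zero fun i => Matrix.toLin' (C i)
  obtain ⟨a, ha⟩ := LinearMap.exists_forall_apply_ne_zero fun i =>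
    dotProductBilin K K (C i *ᵥ b)
  refine ⟨a, b, fun i hi => ?_⟩
  have h1 : C i *ᵥ b ≠ 0 := by simpa using hb i (by simpa using hi)
  rw [dotProduct_comm]
  refine ha i fun h => h1 ?_
  exact dotProduct_eq_zero _ fun w => LinearMap.congr_fun h w

/-- An entrywise nonnegative matrix has a positive semidefinite factorization whose size is its
positive semidefinite rank. -/
theorem exists_psd_factorization_psdRankC {m n : ℕ} (S : Matrix (Fin m) (Fin n) ℂ)
    (hS : ∀ k ℓ, 0 ≤ S k ℓ) :
    ∃ (A : Fin m → Matrix (Fin (psdRankC S)) (Fin (psdRankC S)) ℂ)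
      (B : Fin n → Matrix (Fin (psdRankC S)) (Fin (psdRankC S)) ℂ),
    (∀ k, (A k).PosSemidef) ∧ (∀ ℓ, (B ℓ).PosSemidef) ∧
    ∀ k ℓ, S k ℓ = ((A k)ᴴ * B ℓ).trace := by
  refine Nat.sInf_mem (s := {q : ℕ | ∃ (A : Fin m → Matrix (Fin q) (Fin q) ℂ)
      (B : Fin n → Matrix (Fin q) (Fin q) ℂ),
    (∀ k, (A k).PosSemidef) ∧ (∀ ℓ, (B ℓ).PosSemidef) ∧
    ∀ k ℓ, S k ℓ = ((A k)ᴴ * B ℓ).trace}) ?_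
  refine ⟨n, fun k => diagonal (S k), fun ℓ => diagonal (Pi.single ℓ 1),
    fun k => .diagonal (hS k), fun ℓ => .diagonal ?_, fun k ℓ => ?_⟩
  · exact Pi.single_nonneg.mpr zero_le_one
  · have hA : (diagonal (S k)).PosSemidef := .diagonal (hS k)
    rw [hA.isHermitian.eq, diagonal_mul_diagonal, trace_diagonal]
    simp [Pi.single_apply]

theorem psdRankC_le_of_factorization {m n q : ℕ} {S : Matrix (Fin m) (Fin n) ℂ}
    (A : Fin m → Matrix (Fin q) (Fin q) ℂ) (B : Fin n → Matrix (Fin q) (Fin q) ℂ)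
    (hA : ∀ k, (A k).PosSemidef) (hB : ∀ ℓ, (B ℓ).PosSemidef)
    (h : ∀ k ℓ, S k ℓ = ((A k)ᴴ * B ℓ).trace) : psdRankC S ≤ q :=
  Nat.sInf_le ⟨A, B, hA, hB, h⟩

/-- An entrywise nonnegative matrix has the same support as some matrix whose rank is at most
its positive semidefinite rank. -/
theorem exists_rank_le_psdRankC {m n : ℕ} (S : Matrix (Fin m) (Fin n) ℂ)
    (hS : ∀ k ℓ, 0 ≤ S k ℓ) :
    ∃ T : Matrix (Fin m) (Fin n) ℂ, (∀ k ℓ, T k ℓ = 0 ↔ S k ℓ = 0) ∧ T.rank ≤ psdRankC S := by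
  obtain ⟨A, B, hA, hB, h⟩ := exists_psd_factorization_psdRankC S hS
  obtain ⟨a, b, hab⟩ :=
    exists_forall_dotProduct_mulVec_ne_zero fun p : Fin m × Fin n => A p.1 * B p.2
  refine ⟨(of fun k => a ᵥ* A k) * (of fun ℓ => B ℓ *ᵥ b)ᵀ, fun k ℓ => ?_,
    (rank_mul_le_left _ _).trans (rank_le_width _)⟩
  have hentry : ((of fun k => a ᵥ* A k) * (of fun ℓ => B ℓ *ᵥ b)ᵀ) k ℓ
      = a ⬝ᵥ (A k * B ℓ) *ᵥ b := by
    rw [← mulVec_mulVec, dotProduct_mulVec]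
    rfl
  rw [hentry, h, (hA k).isHermitian.eq, (hA k).trace_mul_eq_zero_iff (hB ℓ)]
  refine ⟨fun h0 => ?_, fun h0 => by simp [h0]⟩
  by_contra hne
  exact hab (k, ℓ) hne h0

/-- The entrywise squared modulus of a matrix has positive semidefinite rank at most the rank
of the matrix. -/
theorem psdRankC_mul_star_le_rank {m n : ℕ} (T : Matrix (Fin m) (Fin n) ℂ) :
    psdRankC (of fun k ℓ => T k ℓ * star (T k ℓ)) ≤ T.rank := by
  obtain ⟨U, V, hUV⟩ := T.exists_eq_mul_of_rank
  refine psdRankC_le_of_factorization (fun k => vecMulVec (star (U k)) (U k))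
    (fun ℓ => vecMulVec (Vᵀ ℓ) (star (Vᵀ ℓ))) (fun k => posSemidef_vecMulVec_star_self _)
    (fun ℓ => posSemidef_vecMulVec_self_star _) fun k ℓ => ?_
  have hT : T k ℓ = U k ⬝ᵥ Vᵀ ℓ := congrFun (congrFun hUV k) ℓ
  rw [(posSemidef_vecMulVec_star_self (U k)).isHermitian.eq, vecMulVec_mul_vecMulVec,
    of_apply, hT, ← star_dotProduct_star]
  simp [trace_smul, trace_vecMulVec, dotProduct_comm]

theorem min_psdRankC_eq_min_rank {m n : ℕ} (M : Matrix (Fin m) (Fin n) ℂ)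
    (hM : ∀ k ℓ, M k ℓ = 0 ∨ M k ℓ = 1) :
    sInf {q : ℕ | ∃ T : Matrix (Fin m) (Fin n) ℂ,
        (∀ k ℓ, ∃ r : ℝ, 0 ≤ r ∧ T k ℓ = (r : ℂ)) ∧
        (∀ k ℓ, T k ℓ ≠ 0 ↔ M k ℓ = 1) ∧ psdRankC T = q} =
    sInf {q : ℕ | ∃ T : Matrix (Fin m) (Fin n) ℂ,
        (∀ k ℓ, T k ℓ ≠ 0 ↔ M k ℓ = 1) ∧ T.rank = q} := by
  have hsq (z : ℂ) : z * star z = (Complex.normSq z : ℂ) := Complex.mul_conj z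
  have hsupp : ∀ k ℓ, M k ℓ ≠ 0 ↔ M k ℓ = 1 := fun k ℓ => by
    rcases hM k ℓ with h | h <;> simp [h]
  apply le_antisymm
  · refine le_csInf ⟨M.rank, M, hsupp, rfl⟩ ?_
    rintro _ ⟨T, hT, rfl⟩
    refine le_trans (Nat.sInf_le ?_) (psdRankC_mul_star_le_rank T)
    refine ⟨_, fun k ℓ => ⟨_, Complex.normSq_nonneg _, hsq _⟩, fun k ℓ => ?_, rfl⟩
    simpa using hT k ℓ
  · refine le_csInf ⟨_, M, fun k ℓ => ?_, hsupp, rfl⟩ ?_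
    · rcases hM k ℓ with h | h
      · exact ⟨0, le_rfl, by simp [h]⟩
      · exact ⟨1, zero_le_one, by simp [h]⟩
    rintro _ ⟨S, hS, hSM, rfl⟩
    obtain ⟨T, hTS, hT⟩ := exists_rank_le_psdRankC S fun k ℓ => by
      obtain ⟨r, hr, h⟩ := hS k ℓ
      rw [h]
      exact_mod_cast hr
    refine le_trans (Nat.sInf_le ?_) hT
    exact ⟨T, fun k ℓ => (hTS k ℓ).not.trans (hSM k ℓ), rfl⟩
end

section
/- Let S be a nonnegative real m×n matrix and r a positive integer. Suppose there exist distinct row indices k_1,…,k_r and distinct column indices ℓ_1,…,ℓ_r such that S(k_i, ℓ_i) ≠ 0 for all i, and S(k_i, ℓ_j) = 0 whenever i < j. Then psdrk(S) ≥ r. (That is, the triangular rank of S is a lower bound on the positive semidefinite rank of S.) -/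
open Matrix

/-- The positive semidefinite rank of a real `m × n` matrix `S`. -/
noncomputable def psdRank {m n : ℕ} (S : Matrix (Fin m) (Fin n) ℝ) : ℕ :=
  sInf {q : ℕ | ∃ (A : Fin m → Matrix (Fin q) (Fin q) ℝ)
      (B : Fin n → Matrix (Fin q) (Fin q) ℝ),
    (∀ k, (A k).PosSemidef) ∧ (∀ ℓ, (B ℓ).PosSemidef) ∧
    ∀ k ℓ, S k ℓ = ((A k)ᵀ * B ℓ).trace}

open scoped MatrixOrder in
theorem Matrix.PosSemidef.mul_eq_zero_of_trace_mul_eq_zero {ι : Type*} [Fintype ι]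
    {A B : Matrix ι ι ℝ} (hA : A.PosSemidef) (hB : B.PosSemidef) (h : (A * B).trace = 0) :
    A * B = 0 := by
  classical
  obtain ⟨X, rfl⟩ := CStarAlgebra.nonneg_iff_eq_star_mul_self.mp hA.nonneg
  obtain ⟨Y, rfl⟩ := CStarAlgebra.nonneg_iff_eq_star_mul_self.mp hB.nonneg
  simp only [star_eq_conjTranspose] at h ⊢
  have hXY : X * Yᴴ = 0 := by
    rw [← trace_mul_conjTranspose_self_eq_zero_iff, conjTranspose_mul, conjTranspose_conjTranspose,
      ← Matrix.mul_assoc, Matrix.trace_mul_comm, ← h]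
    simp only [Matrix.mul_assoc]
  rw [Matrix.mul_assoc, ← Matrix.mul_assoc X, hXY, Matrix.zero_mul, Matrix.mul_zero]

/-- Vectors are linearly independent if linear maps detect them in a triangular pattern. -/
theorem linearIndependent_of_triangular {K V W : Type*} [Field K] [AddCommGroup V] [Module K V]
    [AddCommGroup W] [Module K W] {r : ℕ} (f : Fin r → V →ₗ[K] W) (w : Fin r → V)
    (hdiag : ∀ i, f i (w i) ≠ 0) (htri : ∀ i j, i < j → f i (w j) = 0) :
    LinearIndependent K w := by
  rw [Fintype.linearIndependent_iff]
  intro c hc i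
  induction i using WellFoundedLT.induction with
  | ind i ih =>
    have h := congrArg (f i) hc
    rw [map_sum, map_zero, Finset.sum_eq_single i, map_smul] at h
    · exact (smul_eq_zero.mp h).resolve_right (hdiag i)
    · intro j _ hji
      rw [map_smul]
      rcases lt_or_gt_of_ne hji with hlt | hgt
      · rw [ih j hlt, zero_smul]
      · rw [htri i j hgt, smul_zero]
    · simp

theorem exists_posSemidef_factorization {m n : ℕ} (S : Matrix (Fin m) (Fin n) ℝ)
    (hS : ∀ k ℓ, 0 ≤ S k ℓ) :
    ∃ (A : Fin m → Matrix (Fin n) (Fin n) ℝ) (B : Fin n → Matrix (Fin n) (Fin n) ℝ),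
      (∀ k, (A k).PosSemidef) ∧ (∀ ℓ, (B ℓ).PosSemidef) ∧
      ∀ k ℓ, S k ℓ = ((A k)ᵀ * B ℓ).trace := by
  refine ⟨fun k => diagonal (S k), fun ℓ => diagonal (Pi.single ℓ 1), fun k => ?_, fun ℓ => ?_,
    fun k ℓ => ?_⟩
  · exact PosSemidef.diagonal (hS k)
  · exact PosSemidef.diagonal (Pi.single_nonneg.mpr zero_le_one)
  · simp [trace_diagonal, Pi.single_apply]

theorem triangular_rank_le_psdRank {m n r : ℕ} (hr : 0 < r)
    (S : Matrix (Fin m) (Fin n) ℝ) (hS : ∀ k ℓ, 0 ≤ S k ℓ)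
    (k : Fin r → Fin m) (ℓ : Fin r → Fin n)
    (hk : Function.Injective k) (hℓ : Function.Injective ℓ)
    (hdiag : ∀ i, S (k i) (ℓ i) ≠ 0)
    (htri : ∀ i j, i < j → S (k i) (ℓ j) = 0) :
    r ≤ psdRank S := by
  refine le_csInf ⟨n, exists_posSemidef_factorization S hS⟩ ?_
  rintro q ⟨A, B, hA, hB, hAB⟩
  have hne : ∀ i, ∃ x, ((A (k i))ᵀ * B (ℓ i)) *ᵥ x ≠ 0 := by
    intro i
    by_contra! h
    have h0 : (A (k i))ᵀ * B (ℓ i) = 0 := ext_of_mulVec_single fun j => by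
      rw [h, zero_mulVec]
    exact hdiag i (by rw [hAB, h0, trace_zero])
  choose x hx using hne
  have hli := linearIndependent_of_triangular (fun i => (A (k i))ᵀ.mulVecLin)
    (fun i => B (ℓ i) *ᵥ x i) (fun i => by
      rw [mulVecLin_apply, mulVec_mulVec]
      exact hx i) (fun i j hij => by
      have h0 := (hA (k i)).transpose.mul_eq_zero_of_trace_mul_eq_zero (hB (ℓ j))
        (by rw [← hAB, htri i j hij])
      rw [mulVecLin_apply, mulVec_mulVec, h0, zero_mulVec])
  simpa using hli.fintype_card_le_finrank
end
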